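/- arXiv:2206.03151 — 2 statements merged into one kernel-verified Lean document; each statement's English description precedes it below -/
import Mathlib

section
/- Lemma A.3 (moment lower bound, Equation 11). Fix a real ε0 ≥ 0, an integer k ≥ 1, γ ∈ [0,1], and an integer λ ≥ 2. Then Σ_{m=0}^{k} μ0(m) · ( p_k(m)/q_k(m) )^λ ≥ 1 + C(λ,2) · γ² · (e^{ε0}−1)² / (k e^{ε0}). -/
open Finset

/-- `ρ = 1/(e^{ε0}+1)`. -/
noncomputable def rho (ε0 : ℝ) : ℝ := 1 / (Real.exp ε0 + 1)

/-- Distribution of the number of ones output by the shuffled `ε0`-LDP binary randomized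
response applied to the all-zeros database: `μ0(m) = C(k,m) ρ^m (1−ρ)^{k−m}`. -/
noncomputable def mu0 (ε0 : ℝ) (k m : ℕ) : ℝ :=
  (k.choose m : ℝ) * rho ε0 ^ m * (1 - rho ε0) ^ (k - m)

/-- Distribution of the number of ones for the adjacent database with one entry equal to 1:
`μ1(m) = (1−ρ)·C(k−1,m−1) ρ^{m−1} (1−ρ)^{k−m} + ρ·C(k−1,m) ρ^m (1−ρ)^{k−m−1}`,
with the conventions `C(k−1,−1) = C(k−1,k) = 0`. -/
noncomputable def mu1 (ε0 : ℝ) (k m : ℕ) : ℝ :=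
  (if m = 0 then 0 else
    (1 - rho ε0) * ((k - 1).choose (m - 1) : ℝ) * rho ε0 ^ (m - 1) * (1 - rho ε0) ^ (k - m))
  + rho ε0 * ((k - 1).choose m : ℝ) * rho ε0 ^ m * (1 - rho ε0) ^ (k - m - 1)

/-- `q_k(m) = μ0(m)`. -/
noncomputable def qDist (ε0 : ℝ) (k m : ℕ) : ℝ := mu0 ε0 k m

/-- `p_k(m) = (1−γ) μ0(m) + γ μ1(m)`. -/
noncomputable def pDist (ε0 γ : ℝ) (k m : ℕ) : ℝ :=
  (1 - γ) * mu0 ε0 k m + γ * mu1 ε0 k m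

/-- Unnormalised binomial expectation. -/
noncomputable def bE (r s : ℝ) (k : ℕ) (f : ℕ → ℝ) : ℝ :=
  ∑ m ∈ Finset.range (k + 1), (k.choose m : ℝ) * r ^ m * s ^ (k - m) * f m

lemma bE_succ (r s : ℝ) (k : ℕ) (f : ℕ → ℝ) :
    bE r s (k + 1) f = bE r s k (fun m => r * f (m + 1) + s * f m) := by
  unfold bE
  have h := Finset.sum_choose_succ_mul (fun i j => r ^ i * s ^ j * f i) k
  simp only [← mul_assoc] at h
  rw [h, ← Finset.sum_add_distrib]
  refine Finset.sum_congr rfl fun m hm => ?_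
  have hm' : m ≤ k := by simpa [Nat.lt_succ_iff] using hm
  rw [Nat.succ_sub hm', pow_succ, pow_succ]
  ring

lemma bE_congr (r s : ℝ) (k : ℕ) {f g : ℕ → ℝ} (h : ∀ m, f m = g m) :
    bE r s k f = bE r s k g := by
  rw [funext h]

lemma bE_sum (r s : ℝ) (k j : ℕ) (c : ℕ → ℝ) (g : ℕ → ℕ → ℝ) :
    bE r s k (fun m => ∑ i ∈ Finset.range j, c i * g i m)
      = ∑ i ∈ Finset.range j, c i * bE r s k (g i) := by
  unfold bE
  simp only [Finset.mul_sum]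
  rw [Finset.sum_comm]
  refine Finset.sum_congr rfl fun i _ => Finset.sum_congr rfl fun m _ => by ring

lemma bern_nonneg (r : ℝ) (h0 : 0 ≤ r) (h1 : r ≤ 1 / 2) (j : ℕ) :
    0 ≤ r * (1 - r) ^ j + (1 - r) * (-r) ^ j := by
  rcases j with _ | j
  · simp
  · have hp : r ^ j ≤ (1 - r) ^ j := pow_le_pow_left₀ h0 (by linarith) j
    have h2 : |(-r) ^ j| ≤ (1 - r) ^ j := by
      rw [abs_pow, abs_neg, abs_of_nonneg h0]; exact hp
    have h3 := (abs_le.1 h2).2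
    have : r * (1 - r) ^ (j + 1) + (1 - r) * (-r) ^ (j + 1)
        = r * (1 - r) * ((1 - r) ^ j - (-r) ^ j) := by ring
    rw [this]
    exact mul_nonneg (mul_nonneg h0 (by linarith)) (by linarith)

noncomputable def bM (r : ℝ) (k j : ℕ) : ℝ :=
  bE r (1 - r) k (fun m => ((m : ℝ) - k * r) ^ j)

lemma bM_succ (r : ℝ) (k j : ℕ) :
    bM r (k + 1) j = ∑ i ∈ Finset.range (j + 1),
      ((j.choose i : ℝ) * (r * (1 - r) ^ (j - i) + (1 - r) * (-r) ^ (j - i))) * bM r k i := by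
  unfold bM
  rw [bE_succ, ← bE_sum]
  refine bE_congr _ _ _ fun m => ?_
  have e1 : ((m + 1 : ℕ) : ℝ) - ((k + 1 : ℕ) : ℝ) * r = ((m : ℝ) - k * r) + (1 - r) := by
    push_cast; ring
  have e2 : (m : ℝ) - ((k + 1 : ℕ) : ℝ) * r = ((m : ℝ) - k * r) + (-r) := by
    push_cast; ring
  rw [e1, e2, add_pow, add_pow, Finset.mul_sum, Finset.mul_sum, ← Finset.sum_add_distrib]
  refine Finset.sum_congr rfl fun i _ => by ring

lemma bM_nonneg (r : ℝ) (h0 : 0 ≤ r) (h1 : r ≤ 1 / 2) (k : ℕ) : ∀ j, 0 ≤ bM r k j := by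
  induction k with
  | zero =>
    intro j
    simp only [bM, bE]
    simp
  | succ k ih =>
    intro j
    rw [bM_succ]
    exact Finset.sum_nonneg fun i _ =>
      mul_nonneg (mul_nonneg (Nat.cast_nonneg _) (bern_nonneg r h0 h1 _)) (ih i)

lemma bM_low (r : ℝ) (k : ℕ) :
    bM r k 0 = 1 ∧ bM r k 1 = 0 ∧ bM r k 2 = k * r * (1 - r) := by
  induction k with
  | zero => simp [bM, bE]
  | succ k ih =>
    obtain ⟨a, b, c⟩ := ih
    refine ⟨?_, ?_, ?_⟩
    · rw [bM_succ]; simp [a]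
    · rw [bM_succ]; simp [Finset.sum_range_succ, a, b]; ring
    · rw [bM_succ]; simp [Finset.sum_range_succ, a, b, c]; ring

lemma mu1_eq (ε0 : ℝ) (n m : ℕ) (hm : m ≤ n + 1) (hr : rho ε0 ≠ 0) (hs : 1 - rho ε0 ≠ 0) :
    mu1 ε0 (n + 1) m = mu0 ε0 (n + 1) m *
      (((1 - rho ε0) / rho ε0 * m + rho ε0 / (1 - rho ε0) * (n + 1 - m)) / (n + 1)) := by
  unfold mu1 mu0
  generalize rho ε0 = r at *
  have hn : (n : ℝ) + 1 ≠ 0 := by positivity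
  have B : r * (n.choose m : ℝ) * r ^ m * (1 - r) ^ (n + 1 - m - 1)
      = ((n + 1).choose m : ℝ) * r ^ m * (1 - r) ^ (n + 1 - m)
        * (r / (1 - r) * (n + 1 - m) / (n + 1)) := by
    have hc : (n.choose m : ℝ) * (n + 1) = ((n + 1).choose m : ℝ) * (n + 1 - m) := by
      have := Nat.choose_mul_succ_eq n m
      have h2 : ((n.choose m * (n + 1) : ℕ) : ℝ) = (((n + 1).choose m * (n + 1 - m) : ℕ) : ℝ) := by
        rw [this]
      rw [Nat.cast_mul, Nat.cast_mul, Nat.cast_sub hm] at h2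
      push_cast at h2
      exact h2
    rcases Nat.lt_or_ge n m with h | h
    · have : m = n + 1 := by omega
      subst this
      simp
    · have e : n + 1 - m = (n - m) + 1 := by omega
      have hc' : (n.choose m : ℝ) = ((n + 1).choose m : ℝ) * (n + 1 - m) / (n + 1) := by
        rw [eq_div_iff hn, hc]
      rw [e, Nat.add_sub_cancel, hc', pow_succ]
      field_simp
  have A : (if m = 0 then 0 else
      (1 - r) * (n.choose (m - 1) : ℝ) * r ^ (m - 1) * (1 - r) ^ (n + 1 - m))
      = ((n + 1).choose m : ℝ) * r ^ m * (1 - r) ^ (n + 1 - m)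
        * ((1 - r) / r * m / (n + 1)) := by
    rcases m with _ | m
    · simp
    · have hc : ((n : ℝ) + 1) * (n.choose m : ℝ) = ((n + 1).choose (m + 1) : ℝ) * (m + 1) := by
        exact_mod_cast Nat.add_one_mul_choose_eq n m
      have hc' : (n.choose m : ℝ) = ((n + 1).choose (m + 1) : ℝ) * (m + 1) / (n + 1) := by
        rw [eq_div_iff hn, ← hc]; ring
      simp only [Nat.add_sub_cancel, if_neg (Nat.succ_ne_zero m)]
      rw [hc', pow_succ]
      push_cast
      field_simp
  rw [Nat.add_sub_cancel, A, B]
  ring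

/-- Lemma A.3 (moment lower bound, Equation 11). -/
theorem moment_lower_bound
    (ε0 : ℝ) (hε0 : 0 ≤ ε0) (k : ℕ) (hk : 1 ≤ k) (γ : ℝ) (hγ0 : 0 ≤ γ) (hγ1 : γ ≤ 1)
    (lam : ℕ) (hlam : 2 ≤ lam) :
    1 + (lam.choose 2 : ℝ) * γ ^ 2 * (Real.exp ε0 - 1) ^ 2 / ((k : ℝ) * Real.exp ε0)
      ≤ ∑ m ∈ Finset.range (k + 1),
          mu0 ε0 k m * (pDist ε0 γ k m / qDist ε0 k m) ^ lam := by
  obtain ⟨n, rfl⟩ : ∃ n, k = n + 1 := ⟨k - 1, by omega⟩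
  have hE : 1 ≤ Real.exp ε0 := Real.one_le_exp hε0
  have hr : rho ε0 = 1 / (Real.exp ε0 + 1) := rfl
  have hs : 1 - rho ε0 = Real.exp ε0 / (Real.exp ε0 + 1) := by
    rw [hr]; field_simp; ring
  have hr0 : 0 < rho ε0 := by rw [hr]; positivity
  have hs0 : 0 < 1 - rho ε0 := by rw [hs]; positivity
  have hr2 : rho ε0 ≤ 1 / 2 := by
    rw [hr]; exact one_div_le_one_div_of_le (by norm_num) (by linarith)
  have hn : (0 : ℝ) < (n : ℝ) + 1 := by positivity
  set c : ℝ := γ * (Real.exp ε0 - 1 / Real.exp ε0) / (n + 1) with hc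
  have hc0 : 0 ≤ c := by
    have : 1 / Real.exp ε0 ≤ 1 := by rw [div_le_one (by positivity)]; exact hE
    rw [hc]
    exact div_nonneg (mul_nonneg hγ0 (by linarith)) hn.le
  have key : ∑ m ∈ Finset.range (n + 1 + 1),
      mu0 ε0 (n + 1) m * (pDist ε0 γ (n + 1) m / qDist ε0 (n + 1) m) ^ lam
      = ∑ i ∈ Finset.range (lam + 1), ((lam.choose i : ℝ) * c ^ i) * bM (rho ε0) (n + 1) i := by
    unfold bM
    rw [← bE_sum]
    unfold bE
    refine Finset.sum_congr rfl fun m hm => ?_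
    have hm' : m ≤ n + 1 := by simpa [Nat.lt_succ_iff] using hm
    have hmu : 0 < mu0 ε0 (n + 1) m := by
      unfold mu0
      have : 0 < (n + 1).choose m := Nat.choose_pos hm'
      positivity
    have ratio : pDist ε0 γ (n + 1) m / qDist ε0 (n + 1) m
        = c * ((m : ℝ) - ((n + 1 : ℕ) : ℝ) * rho ε0) + 1 := by
      unfold pDist qDist
      rw [mu1_eq ε0 n m hm' hr0.ne' hs0.ne', div_eq_iff hmu.ne', hs, hr, hc]
      have := Real.exp_pos ε0
      push_cast
      field_simp
      ring
    rw [ratio, add_pow]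
    unfold mu0
    congr 1
    refine Finset.sum_congr rfl fun i _ => ?_
    rw [mul_pow]; ring
  rw [key]
  obtain ⟨a, b, d⟩ := bM_low (rho ε0) (n + 1)
  have hsub : Finset.range 3 ⊆ Finset.range (lam + 1) :=
    Finset.range_subset_range.2 (by omega)
  refine le_trans (le_of_eq ?_) (Finset.sum_le_sum_of_subset_of_nonneg hsub fun i _ _ =>
    mul_nonneg (mul_nonneg (Nat.cast_nonneg _) (pow_nonneg hc0 i))
      (bM_nonneg _ hr0.le hr2 _ i))
  simp only [Finset.sum_range_succ, Finset.sum_range_zero, a, b, d]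
  rw [hs, hr, hc]
  have := Real.exp_pos ε0
  push_cast
  simp only [Nat.choose_zero_right, pow_zero]
  field_simp
  ring
end

section
/- Positivity of the subsampled likelihood ratio. Fix a real ε0 ≥ 0, an integer k ≥ 1, and γ ∈ [0,1]. Then for every m ∈ {0,1,…,k}, p_k(m)/q_k(m) = 1 + γ (e^{2ε0}−1)/(k e^{ε0}) · (m − k/(e^{ε0}+1)) ≥ 1 − γ (e^{ε0}−1)/e^{ε0} ≥ e^{−ε0} > 0. -/
open Finset

lemma mu1_eq_aux (ε0 : ℝ) (k : ℕ) (hk : 1 ≤ k) (m : ℕ) (hm : m ≤ k) :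
    mu1 ε0 k m = (Real.exp ε0 * m / k + (k - m) / (k * Real.exp ε0)) * mu0 ε0 k m := by
  have hx := Real.exp_pos ε0
  have hr : 0 < rho ε0 := by unfold rho; positivity
  have hs : 1 - rho ε0 = Real.exp ε0 * rho ε0 := by unfold rho; field_simp; ring
  have hk' : (0 : ℝ) < k := by exact_mod_cast hk
  have h1 : (if m = 0 then 0 else
      (1 - rho ε0) * ((k - 1).choose (m - 1) : ℝ) * rho ε0 ^ (m - 1) * (1 - rho ε0) ^ (k - m))
      = Real.exp ε0 * m / k * mu0 ε0 k m := by
    obtain ⟨n, rfl⟩ : ∃ n, k = n + 1 := ⟨k - 1, by omega⟩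
    rcases m with _ | j
    · simp
    · have hc : ((n : ℝ) + 1) * (n.choose j : ℝ) = ((n + 1).choose (j + 1) : ℝ) * (j + 1) := by
        exact_mod_cast Nat.add_one_mul_choose_eq n j
      simp only [Nat.add_one_ne_zero, if_false, Nat.add_sub_cancel, mu0]
      generalize (1 - rho ε0) ^ (n + 1 - (j + 1)) = S
      rw [hs, div_mul_eq_mul_div, eq_div_iff hk'.ne', pow_succ]
      push_cast
      linear_combination Real.exp ε0 * rho ε0 * rho ε0 ^ j * S * hc
  have h2 : rho ε0 * ((k - 1).choose m : ℝ) * rho ε0 ^ m * (1 - rho ε0) ^ (k - m - 1)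
      = (k - m) / (k * Real.exp ε0) * mu0 ε0 k m := by
    rcases hm.eq_or_lt with rfl | hlt
    · rw [Nat.choose_eq_zero_of_lt (by omega)]; simp
    · obtain ⟨d, rfl⟩ : ∃ d, k = m + d + 1 := ⟨k - m - 1, by omega⟩
      have hc : ((m + d).choose m : ℝ) * (m + d + 1) = ((m + d + 1).choose m : ℝ) * (d + 1) := by
        have := Nat.choose_mul_succ_eq (m + d) m
        rw [show m + d + 1 - m = d + 1 by omega] at this
        exact_mod_cast this
      have e1 : m + d + 1 - m = d + 1 := by omega
      simp only [mu0, Nat.add_sub_cancel, e1]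
      rw [pow_succ]
      generalize hS : (1 - rho ε0) ^ d = S
      rw [hs, div_mul_eq_mul_div, eq_div_iff (by positivity)]
      push_cast
      linear_combination Real.exp ε0 * rho ε0 * rho ε0 ^ m * S * hc
  rw [mu1, h1, h2]; ring

/-- Positivity of the subsampled likelihood ratio:
`p_k(m)/q_k(m) = 1 + γ(e^{2ε0}−1)/(k e^{ε0})·(m − k/(e^{ε0}+1)) ≥ 1 − γ(e^{ε0}−1)/e^{ε0}
≥ e^{−ε0} > 0`. -/
theorem subsampled_ratio_positive
    (ε0 : ℝ) (hε0 : 0 ≤ ε0) (k : ℕ) (hk : 1 ≤ k) (γ : ℝ) (hγ0 : 0 ≤ γ) (hγ1 : γ ≤ 1)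
    (m : ℕ) (hm : m ≤ k) :
    pDist ε0 γ k m / qDist ε0 k m
        = 1 + γ * (Real.exp (2 * ε0) - 1) / ((k : ℝ) * Real.exp ε0)
            * ((m : ℝ) - (k : ℝ) / (Real.exp ε0 + 1))
      ∧ 1 - γ * (Real.exp ε0 - 1) / Real.exp ε0 ≤ pDist ε0 γ k m / qDist ε0 k m
      ∧ Real.exp (-ε0) ≤ 1 - γ * (Real.exp ε0 - 1) / Real.exp ε0
      ∧ 0 < Real.exp (-ε0) := by
  have hx := Real.exp_pos ε0
  have hx1 : 1 ≤ Real.exp ε0 := Real.one_le_exp hε0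
  have hk' : (0 : ℝ) < k := by exact_mod_cast hk
  have hq : 0 < mu0 ε0 k m := by
    have hr : 0 < rho ε0 := by unfold rho; positivity
    have hs : 1 - rho ε0 = Real.exp ε0 * rho ε0 := by unfold rho; field_simp; ring
    have hc : (0 : ℝ) < k.choose m := by exact_mod_cast Nat.choose_pos hm
    unfold mu0
    rw [hs]
    positivity
  have h2 : Real.exp (2 * ε0) = Real.exp ε0 ^ 2 := by
    rw [← Real.exp_nat_mul]; norm_num
  have key : pDist ε0 γ k m / qDist ε0 k m
      = 1 - γ * (Real.exp ε0 - 1) / Real.exp ε0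
        + γ * (Real.exp ε0 ^ 2 - 1) * m / (k * Real.exp ε0) := by
    rw [pDist, qDist, mu1_eq_aux ε0 k hk m hm, div_eq_iff hq.ne']
    field_simp
    ring
  refine ⟨?_, ?_, ?_, Real.exp_pos _⟩
  · rw [key, h2]
    field_simp
    ring
  · rw [key]
    have : 0 ≤ Real.exp ε0 ^ 2 - 1 := by nlinarith
    have : 0 ≤ γ * (Real.exp ε0 ^ 2 - 1) * m / (k * Real.exp ε0) := by positivity
    linarith
  · rw [Real.exp_neg, inv_eq_one_div, le_sub_iff_add_le, ← add_div, div_le_one hx]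
    nlinarith
end
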